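/- Fix s∈ℝ, q≥0 and β∈ℝ. For every a∈[0,1]² the limit P_a(s,q) = lim_{k→∞} (Ψ^{s,q}_{a,k})^{1/k} exists, where Ψ^{s,q}_{a,k} = Σ_{𝔦∈𝓘^k} ψ^{s,q}_a(𝔦); moreover this limit is independent of the choice of a∈[0,1]², i.e. P_a(s,q) = P_b(s,q) for all a,b∈[0,1]². -/

import Mathlib

/-!
Setting (Falconer–Fraser–Lee, "L^q-spectra of measures on planar non-conformal attractors"):
a finite family of C^{1+α} skew-product contractions
`S i (x,y) = (f i x, g i (x,y))` of the unit square, satisfying a domination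
condition on the (lower triangular) Jacobians.
-/

open Set Filter Topology MeasureTheory
open scoped Classical ENNReal

noncomputable section

/-- The closed unit square `[0,1]² ⊆ ℝ²`. -/
def unitSq : Set (ℝ × ℝ) := Set.Icc (0:ℝ) 1 ×ˢ Set.Icc (0:ℝ) 1

variable {ι : Type*} [Fintype ι]

/-- The skew-product map `S_i(x,y) = (f_i x, g_i (x,y))`. -/
def Smap (f : ι → ℝ → ℝ) (g : ι → ℝ × ℝ → ℝ) (i : ι) : ℝ × ℝ → ℝ × ℝ :=
  fun a => (f i a.1, g i a)

/-- The composition `S_𝔦 = S_{i₁} ∘ ⋯ ∘ S_{i_k}` along a finite word `𝔦 = [i₁, …, i_k]`. -/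
def Sword (f : ι → ℝ → ℝ) (g : ι → ℝ × ℝ → ℝ) : List ι → ℝ × ℝ → ℝ × ℝ
  | [] => id
  | i :: l => Smap f g i ∘ Sword f g l

/-- The first component `f_𝔦 = f_{i₁} ∘ ⋯ ∘ f_{i_k}` of `S_𝔦` (a function of `x` only). -/
def fword (f : ι → ℝ → ℝ) : List ι → ℝ → ℝ
  | [] => id
  | i :: l => f i ∘ fword f l

/-- Top-left entry `f_{𝔦,x}(a)` of the (lower triangular) Jacobian `D_a S_𝔦`. -/
def fxw (f : ι → ℝ → ℝ) (g : ι → ℝ × ℝ → ℝ) (l : List ι) (a : ℝ × ℝ) : ℝ :=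
  deriv (fun x => (Sword f g l (x, a.2)).1) a.1

/-- Bottom-left entry `g_{𝔦,x}(a)` of the Jacobian `D_a S_𝔦`. -/
def gxw (f : ι → ℝ → ℝ) (g : ι → ℝ × ℝ → ℝ) (l : List ι) (a : ℝ × ℝ) : ℝ :=
  deriv (fun x => (Sword f g l (x, a.2)).2) a.1

/-- Bottom-right entry `g_{𝔦,y}(a)` of the Jacobian `D_a S_𝔦`. -/
def gyw (f : ι → ℝ → ℝ) (g : ι → ℝ × ℝ → ℝ) (l : List ι) (a : ℝ × ℝ) : ℝ :=
  deriv (fun y => (Sword f g l (a.1, y)).2) a.2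

/-- The standing hypotheses: `|𝓘| ≥ 2`; each `S_i(x,y) = (f_i x, g_i(x,y))` maps the unit
square into itself; `f_i, g_i` are `C^{1+α}` contractions (`0 < α ≤ 1`); and the
domination condition `inf f_{i,x} > sup g_{i,y} ≥ inf g_{i,y} ≥ d > 0` holds. -/
structure IFSHyp (f : ι → ℝ → ℝ) (g : ι → ℝ × ℝ → ℝ) (α d : ℝ) : Prop where
  card2 : 2 ≤ Fintype.card ι
  alpha_pos : 0 < α
  alpha_le_one : α ≤ 1
  d_pos : 0 < d
  maps_f : ∀ i, Set.MapsTo (f i) (Set.Icc 0 1) (Set.Icc 0 1)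
  maps_g : ∀ i, Set.MapsTo (g i) unitSq (Set.Icc 0 1)
  diff_f : ∀ i, Differentiable ℝ (f i)
  diff_g : ∀ i, Differentiable ℝ (g i)
  holder_f : ∀ i, ∃ H : ℝ, ∀ x ∈ Set.Icc (0:ℝ) 1, ∀ y ∈ Set.Icc (0:ℝ) 1,
      |deriv (f i) x - deriv (f i) y| ≤ H * |x - y| ^ α
  holder_g : ∀ i, ∃ H : ℝ, ∀ a ∈ unitSq, ∀ b ∈ unitSq,
      ‖fderiv ℝ (g i) a - fderiv ℝ (g i) b‖ ≤ H * ‖a - b‖ ^ α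
  contr_f : ∀ i, ∃ c, 0 ≤ c ∧ c < 1 ∧ ∀ x ∈ Set.Icc (0:ℝ) 1, ∀ y ∈ Set.Icc (0:ℝ) 1,
      |f i x - f i y| ≤ c * |x - y|
  contr_g : ∀ i, ∃ c, 0 ≤ c ∧ c < 1 ∧ ∀ a ∈ unitSq, ∀ b ∈ unitSq,
      |g i a - g i b| ≤ c * ‖a - b‖
  dom : ∀ i, sSup (gyw f g [i] '' unitSq) < sInf (fxw f g [i] '' unitSq)
  dom_d : ∀ i, ∀ a ∈ unitSq, d ≤ gyw f g [i] a

/-- The larger singular value of the lower triangular matrix `A = [[a,0],[b,c]]`, i.e. the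
square root of the larger eigenvalue of `AᵀA`, in explicit closed form. -/
def sv1 (a b c : ℝ) : ℝ :=
  Real.sqrt (((a ^ 2 + b ^ 2 + c ^ 2) +
    Real.sqrt ((a ^ 2 + b ^ 2 + c ^ 2) ^ 2 - 4 * (a * c) ^ 2)) / 2)

/-- The smaller singular value of the lower triangular matrix `A = [[a,0],[b,c]]`, i.e. the
square root of the smaller eigenvalue of `AᵀA`, in explicit closed form. -/
def sv2 (a b c : ℝ) : ℝ :=
  Real.sqrt (((a ^ 2 + b ^ 2 + c ^ 2) -
    Real.sqrt ((a ^ 2 + b ^ 2 + c ^ 2) ^ 2 - 4 * (a * c) ^ 2)) / 2)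

/-- `α₁(D_a S_𝔦)`, the larger singular value of the Jacobian. -/
def alphaOne (f : ι → ℝ → ℝ) (g : ι → ℝ × ℝ → ℝ) (l : List ι) (a : ℝ × ℝ) : ℝ :=
  sv1 (fxw f g l a) (gxw f g l a) (gyw f g l a)

/-- `α₂(D_a S_𝔦)`, the smaller singular value of the Jacobian. -/
def alphaTwo (f : ι → ℝ → ℝ) (g : ι → ℝ × ℝ → ℝ) (l : List ι) (a : ℝ × ℝ) : ℝ :=
  sv2 (fxw f g l a) (gxw f g l a) (gyw f g l a)

/-- `η = sup_{i, a, b} g_{i,y}(a) / f_{i,x}(b)`. -/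
def etaSup (f : ι → ℝ → ℝ) (g : ι → ℝ × ℝ → ℝ) : ℝ :=
  sSup {x : ℝ | ∃ i : ι, ∃ a ∈ unitSq, ∃ b ∈ unitSq, x = gyw f g [i] a / fxw f g [i] b}

/-- `p(𝔦) = p_{i₁} ⋯ p_{i_k}`. -/
def pword (p : ι → ℝ) (l : List ι) : ℝ := (l.map p).prod

/-- `(p_i)` is a probability vector with all entries in `(0,1)`. -/
def ProbVec (p : ι → ℝ) : Prop := (∀ i, 0 < p i ∧ p i < 1) ∧ ∑ i, p i = 1

/-- The `q`-modified singular value function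
`ψ^{s,q}_a(𝔦) = p(𝔦)^q α₁(D_aS_𝔦)^βq α₂(D_aS_𝔦)^(s−βq)` (real exponents). -/
def psiSV (f : ι → ℝ → ℝ) (g : ι → ℝ × ℝ → ℝ) (p : ι → ℝ) (s q βq : ℝ)
    (a : ℝ × ℝ) (l : List ι) : ℝ :=
  pword p l ^ q * alphaOne f g l a ^ βq * alphaTwo f g l a ^ (s - βq)

/-- `Ψ^{s,q}_{a,k} = Σ_{𝔦 ∈ 𝓘^k} ψ^{s,q}_a(𝔦)`. -/
def PsiSum (f : ι → ℝ → ℝ) (g : ι → ℝ × ℝ → ℝ) (p : ι → ℝ) (s q βq : ℝ)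
    (a : ℝ × ℝ) (k : ℕ) : ℝ :=
  ∑ w : Fin k → ι, psiSV f g p s q βq a (List.ofFn w)

/-- The `δ`-stopping `𝓘_{a,δ} = {𝔦 : α₂(D_aS_𝔦) < δ ≤ α₂(D_aS_𝔦̂)}`, where `𝔦̂` drops the
last letter of `𝔦`. -/
def stopping (f : ι → ℝ → ℝ) (g : ι → ℝ × ℝ → ℝ) (a : ℝ × ℝ) (δ : ℝ) : Set (List ι) :=
  {l | l ≠ [] ∧ alphaTwo f g l a < δ ∧ δ ≤ alphaTwo f g l.dropLast a}

/-- `q`-th power moment sum of a measure on `ℝ` over the `δ`-mesh intervals of positive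
measure. -/
def msum1 (ν : Measure ℝ) (q δ : ℝ) : ℝ :=
  ∑' k : ℤ, if 0 < ν (Set.Icc ((k : ℝ) * δ) (((k : ℝ) + 1) * δ)) then
    (ν (Set.Icc ((k : ℝ) * δ) (((k : ℝ) + 1) * δ))).toReal ^ q else 0

/-- `q`-th power moment sum of a measure on `ℝ²` over the `δ`-mesh squares of positive
measure. -/
def msum2 (ν : Measure (ℝ × ℝ)) (q δ : ℝ) : ℝ :=
  ∑' k : ℤ × ℤ,
    if 0 < ν (Set.Icc ((k.1 : ℝ) * δ) (((k.1 : ℝ) + 1) * δ) ×ˢ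
        Set.Icc ((k.2 : ℝ) * δ) (((k.2 : ℝ) + 1) * δ)) then
      (ν (Set.Icc ((k.1 : ℝ) * δ) (((k.1 : ℝ) + 1) * δ) ×ˢ
        Set.Icc ((k.2 : ℝ) * δ) (((k.2 : ℝ) + 1) * δ))).toReal ^ q else 0

/-- Upper `L^q`-spectrum of a measure on `ℝ²`. -/
def upperTau2 (ν : Measure (ℝ × ℝ)) (q : ℝ) : ℝ :=
  limsup (fun δ => Real.log (msum2 ν q δ) / (-Real.log δ)) (𝓝[>] (0:ℝ))

/-- Lower `L^q`-spectrum of a measure on `ℝ²`. -/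
def lowerTau2 (ν : Measure (ℝ × ℝ)) (q : ℝ) : ℝ :=
  liminf (fun δ => Real.log (msum2 ν q δ) / (-Real.log δ)) (𝓝[>] (0:ℝ))

/-- Birkhoff sum of the potential `L` along a finite word. -/
def wordSum (f : ι → ℝ → ℝ) (g : ι → ℝ × ℝ → ℝ) (L : ι → ℝ × ℝ → ℝ) : List ι → ℝ × ℝ → ℝ
  | [], _ => 0
  | i :: l, a => L i (Sword f g l a) + wordSum f g L l a

/-- Partition function of the potential `L`: sum over words of length `k`. -/
def partitionSum (f : ι → ℝ → ℝ) (g : ι → ℝ × ℝ → ℝ) (L : ι → ℝ × ℝ → ℝ) (k : ℕ)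
    (a : ℝ × ℝ) : ℝ :=
  ∑ w : Fin k → ι, Real.exp (wordSum f g L (List.ofFn w) a)

/-- The additive potential whose Birkhoff sums are comparable to `log ψ`. -/
def logPotential (f : ι → ℝ → ℝ) (g : ι → ℝ × ℝ → ℝ) (p : ι → ℝ) (s q βq : ℝ)
    (i : ι) (a : ℝ × ℝ) : ℝ :=
  q * Real.log (p i) + βq * Real.log (fxw f g [i] a) + (s - βq) * Real.log (gyw f g [i] a)

theorem Sword_append {ι : Type*} (f : ι → ℝ → ℝ) (g : ι → ℝ × ℝ → ℝ) (l₁ l₂ : List ι) (a : ℝ × ℝ) :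
    Sword f g (l₁ ++ l₂) a = Sword f g l₁ (Sword f g l₂ a) := by
  induction l₁ with
  | nil => simp [Sword]
  | cons i l ih => simp [Sword, ih]

theorem wordSum_append {ι : Type*} (f : ι → ℝ → ℝ) (g : ι → ℝ × ℝ → ℝ) (L : ι → ℝ × ℝ → ℝ)
    (l₁ l₂ : List ι) (a : ℝ × ℝ) :
    wordSum f g L (l₁ ++ l₂) a = wordSum f g L l₁ (Sword f g l₂ a) + wordSum f g L l₂ a := by
  induction l₁ with
  | nil => simp [wordSum]
  | cons i l ih => simp [wordSum, ih, Sword_append, add_assoc]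

theorem partitionSum_add (f : ι → ℝ → ℝ) (g : ι → ℝ × ℝ → ℝ) (L : ι → ℝ × ℝ → ℝ)
    (m n : ℕ) (a : ℝ × ℝ) :
    partitionSum f g L (m + n) a = ∑ v : Fin n → ι,
      partitionSum f g L m (Sword f g (List.ofFn v) a) *
        Real.exp (wordSum f g L (List.ofFn v) a) := by
  unfold partitionSum
  rw [← (Fin.appendEquiv m n).sum_comp, Fintype.sum_prod_type, Finset.sum_comm]
  refine Finset.sum_congr rfl fun v _ => ?_
  rw [Finset.sum_mul]
  refine Finset.sum_congr rfl fun u _ => ?_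
  rw [← Real.exp_add, ← wordSum_append]
  simp [Fin.appendEquiv, List.ofFn_fin_append]

theorem partitionSum_pos [Nonempty ι] (f : ι → ℝ → ℝ) (g : ι → ℝ × ℝ → ℝ)
    (L : ι → ℝ × ℝ → ℝ) (k : ℕ) (a : ℝ × ℝ) : 0 < partitionSum f g L k a :=
  Finset.sum_pos (fun _ _ => Real.exp_pos _) Finset.univ_nonempty

theorem IFSHyp.nonempty {f : ι → ℝ → ℝ} {g : ι → ℝ × ℝ → ℝ} {α d : ℝ}
    (h : IFSHyp f g α d) : Nonempty ι :=
  Fintype.card_pos_iff.mp (by have := h.card2; omega)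

theorem IFSHyp.Smap_mem {f : ι → ℝ → ℝ} {g : ι → ℝ × ℝ → ℝ} {α d : ℝ}
    (h : IFSHyp f g α d) (i : ι) {a : ℝ × ℝ} (ha : a ∈ unitSq) : Smap f g i a ∈ unitSq :=
  ⟨h.maps_f i ha.1, h.maps_g i ha⟩

theorem IFSHyp.Sword_mem {f : ι → ℝ → ℝ} {g : ι → ℝ × ℝ → ℝ} {α d : ℝ}
    (h : IFSHyp f g α d) (l : List ι) {a : ℝ × ℝ} (ha : a ∈ unitSq) :
    Sword f g l a ∈ unitSq := by
  induction l with
  | nil => exact ha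
  | cons i l ih => exact h.Smap_mem i ih

theorem norm_sub_le_one_of_mem_unitSq {a b : ℝ × ℝ} (ha : a ∈ unitSq) (hb : b ∈ unitSq) :
    ‖a - b‖ ≤ 1 := by
  obtain ⟨⟨h1, h2⟩, h3, h4⟩ := ha
  obtain ⟨⟨h5, h6⟩, h7, h8⟩ := hb
  rw [Prod.norm_def, max_le_iff]
  simp only [Prod.fst_sub, Prod.snd_sub, Real.norm_eq_abs, abs_le]
  constructor <;> constructor <;> linarith

theorem zero_mem_unitSq : (0 : ℝ × ℝ) ∈ unitSq := by
  simp [unitSq, Prod.le_def]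

theorem IFSHyp.exists_contraction {f : ι → ℝ → ℝ} {g : ι → ℝ × ℝ → ℝ} {α d : ℝ}
    (h : IFSHyp f g α d) : ∃ c, 0 ≤ c ∧ c < 1 ∧ ∀ (l : List ι), ∀ a ∈ unitSq, ∀ b ∈ unitSq,
      ‖Sword f g l a - Sword f g l b‖ ≤ c ^ l.length := by
  have := h.nonempty
  choose c₁ h0 h1 h2 using h.contr_f
  choose c₂ k0 k1 k2 using h.contr_g
  obtain ⟨i₀, hi₀⟩ := Finite.exists_max (fun i => max (c₁ i) (c₂ i))
  have hc0 : 0 ≤ max (c₁ i₀) (c₂ i₀) := le_max_of_le_left (h0 i₀)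
  refine ⟨max (c₁ i₀) (c₂ i₀), hc0, max_lt (h1 _) (k1 _), fun l a ha b hb => ?_⟩
  generalize max (c₁ i₀) (c₂ i₀) = c at *
  induction l with
  | nil => simpa [Sword] using norm_sub_le_one_of_mem_unitSq ha hb
  | cons i l ih =>
    have hA := h.Sword_mem l ha
    have hB := h.Sword_mem l hb
    set A := Sword f g l a with hAdef
    set B := Sword f g l b with hBdef
    have key : ‖Smap f g i A - Smap f g i B‖ ≤ c * ‖A - B‖ := by
      rw [Prod.norm_def]
      refine max_le ?_ ?_
      · refine (h2 i A.1 hA.1 B.1 hB.1).trans ?_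
        exact mul_le_mul ((le_max_left _ _).trans (hi₀ i)) (norm_fst_le (A - B))
          (abs_nonneg _) hc0
      · refine (k2 i A hA B hB).trans ?_
        exact mul_le_mul_of_nonneg_right ((le_max_right _ _).trans (hi₀ i)) (norm_nonneg _)
    calc ‖Sword f g (i :: l) a - Sword f g (i :: l) b‖ ≤ c * ‖A - B‖ := key
      _ ≤ c * c ^ l.length := mul_le_mul_of_nonneg_left ih hc0
      _ = c ^ (i :: l).length := by simp [pow_succ']

/-- Bounded distortion for Birkhoff sums of Hölder potentials. -/
theorem IFSHyp.exists_distortion {f : ι → ℝ → ℝ} {g : ι → ℝ × ℝ → ℝ} {α d : ℝ}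
    (h : IFSHyp f g α d) {L : ι → ℝ × ℝ → ℝ} {H : ℝ} (hH : 0 ≤ H)
    (hL : ∀ i, ∀ a ∈ unitSq, ∀ b ∈ unitSq, |L i a - L i b| ≤ H * ‖a - b‖ ^ α) :
    ∃ D, ∀ (l : List ι), ∀ a ∈ unitSq, ∀ b ∈ unitSq,
      wordSum f g L l a ≤ D + wordSum f g L l b := by
  obtain ⟨c, hc0, hc1, hc⟩ := h.exists_contraction
  have hr0 : 0 ≤ c ^ α := Real.rpow_nonneg hc0 _
  have hr1 : c ^ α < 1 := Real.rpow_lt_one hc0 hc1 h.alpha_pos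
  have hsum : ∀ (l : List ι), ∀ a ∈ unitSq, ∀ b ∈ unitSq,
      wordSum f g L l a ≤ ∑ j ∈ Finset.range l.length, H * (c ^ α) ^ j + wordSum f g L l b := by
    intro l a ha b hb
    induction l with
    | nil => simp [wordSum]
    | cons i l ih =>
      have h1 := (abs_le.mp (hL i _ (h.Sword_mem l ha) _ (h.Sword_mem l hb))).2
      have h2 : ‖Sword f g l a - Sword f g l b‖ ^ α ≤ (c ^ α) ^ l.length := by
        calc _ ≤ (c ^ l.length) ^ α :=
              Real.rpow_le_rpow (norm_nonneg _) (hc l a ha b hb) h.alpha_pos.le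
          _ = _ := by
              rw [← Real.rpow_natCast, ← Real.rpow_natCast, ← Real.rpow_mul hc0,
                ← Real.rpow_mul hc0, mul_comm]
      have h3 := mul_le_mul_of_nonneg_left h2 hH
      simp only [wordSum, List.length_cons, Finset.sum_range_succ]
      linarith
  refine ⟨∑' j, H * (c ^ α) ^ j, fun l a ha b hb => (hsum l a ha b hb).trans ?_⟩
  gcongr
  exact ((summable_geometric_of_lt_one hr0 hr1).mul_left H).sum_le_tsum _
    (fun j _ => by positivity)

theorem partitionSum_le_of_distortion {f : ι → ℝ → ℝ} {g : ι → ℝ × ℝ → ℝ}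
    {L : ι → ℝ × ℝ → ℝ} {D : ℝ} {a b : ℝ × ℝ}
    (hD : ∀ l : List ι, wordSum f g L l a ≤ D + wordSum f g L l b) (k : ℕ) :
    partitionSum f g L k a ≤ Real.exp D * partitionSum f g L k b := by
  unfold partitionSum
  rw [Finset.mul_sum]
  refine Finset.sum_le_sum fun w _ => ?_
  rw [← Real.exp_add]
  exact Real.exp_le_exp.mpr (hD _)

/-- Existence of the pressure of a Hölder potential. -/
theorem IFSHyp.exists_tendsto_log_partitionSum {f : ι → ℝ → ℝ} {g : ι → ℝ × ℝ → ℝ} {α d : ℝ}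
    (h : IFSHyp f g α d) {L : ι → ℝ × ℝ → ℝ} {H : ℝ} (hH : 0 ≤ H)
    (hL : ∀ i, ∀ a ∈ unitSq, ∀ b ∈ unitSq, |L i a - L i b| ≤ H * ‖a - b‖ ^ α) :
    ∃ P : ℝ, Tendsto (fun k : ℕ => Real.log (partitionSum f g L k 0) / k) atTop (𝓝 P) := by
  have := h.nonempty
  obtain ⟨D, hD⟩ := h.exists_distortion hH hL
  have hpos := fun k => partitionSum_pos f g L k 0
  set u : ℕ → ℝ := fun k => Real.log (partitionSum f g L k 0) with hu
  have hup : ∀ m n, u (m + n) ≤ u m + u n + D := by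
    intro m n
    have : partitionSum f g L (m + n) 0 ≤
        Real.exp D * partitionSum f g L m 0 * partitionSum f g L n 0 := by
      rw [partitionSum_add]
      conv_rhs => rw [partitionSum.eq_def f g L n, Finset.mul_sum]
      refine Finset.sum_le_sum fun v _ => mul_le_mul_of_nonneg_right ?_ (Real.exp_pos _).le
      exact partitionSum_le_of_distortion
        (fun l => hD l _ (h.Sword_mem _ zero_mem_unitSq) _ zero_mem_unitSq) m
    have := Real.log_le_log (hpos _) this
    rw [Real.log_mul (mul_pos (Real.exp_pos _) (hpos m)).ne' (hpos n).ne',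
      Real.log_mul (Real.exp_pos _).ne' (hpos m).ne', Real.log_exp] at this
    simp only [hu]
    linarith
  have hlow : ∀ m n, u m + u n - D ≤ u (m + n) := by
    intro m n
    have : partitionSum f g L m 0 * partitionSum f g L n 0 ≤
        Real.exp D * partitionSum f g L (m + n) 0 := by
      rw [partitionSum_add, Finset.mul_sum]
      conv_lhs => rw [partitionSum.eq_def f g L n, Finset.mul_sum]
      refine Finset.sum_le_sum fun v _ => ?_
      rw [← mul_assoc]
      refine mul_le_mul_of_nonneg_right ?_ (Real.exp_pos _).le
      exact partitionSum_le_of_distortion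
        (fun l => hD l _ zero_mem_unitSq _ (h.Sword_mem _ zero_mem_unitSq)) m
    have := Real.log_le_log (mul_pos (hpos m) (hpos n)) this
    rw [Real.log_mul (hpos m).ne' (hpos n).ne',
      Real.log_mul (Real.exp_pos _).ne' (hpos _).ne', Real.log_exp] at this
    simp only [hu]
    linarith
  have hsub : Subadditive (fun k => u k + D) := fun m n => by
    have := hup m n
    linarith
  have hgrowth : ∀ n : ℕ, (n + 1 : ℝ) * (u 1 - D) ≤ u (n + 1) - D := by
    intro n
    induction n with
    | zero => simp
    | succ n ih =>
      have := hlow (n + 1) 1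
      push_cast
      linarith
  have hbdd : BddBelow (Set.range fun n : ℕ => (u n + D) / n) := by
    have hD0 : 0 ≤ D := by
      have := hD [] 0 zero_mem_unitSq 0 zero_mem_unitSq
      simpa [wordSum] using this
    refine ⟨min 0 (u 1 - D), ?_⟩
    rintro _ ⟨n, rfl⟩
    rcases n with _ | n
    · simp
    · refine (min_le_right _ _).trans ?_
      have hn : (0 : ℝ) < ((n + 1 : ℕ) : ℝ) := by positivity
      rw [le_div_iff₀ hn]
      have := hgrowth n
      push_cast
      linarith
  refine ⟨hsub.lim, ?_⟩
  have h1 := hsub.tendsto_lim hbdd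
  have h2 := h1.sub (tendsto_const_div_atTop_nhds_zero_nat D)
  rw [sub_zero] at h2
  refine h2.congr fun n => ?_
  rw [← sub_div, add_sub_cancel_right]

theorem abs_log_sub_log_le {x y d : ℝ} (hd : 0 < d) (hx : d ≤ x) (hy : d ≤ y) :
    |Real.log x - Real.log y| ≤ |x - y| / d := by
  have key : ∀ x y : ℝ, d ≤ x → d ≤ y → Real.log x - Real.log y ≤ |x - y| / d := by
    intro x y hx hy
    have hx0 : 0 < x := hd.trans_le hx
    have hy0 : 0 < y := hd.trans_le hy
    rw [← Real.log_div hx0.ne' hy0.ne']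
    calc Real.log (x / y) ≤ x / y - 1 := Real.log_le_sub_one_of_pos (div_pos hx0 hy0)
      _ = (x - y) / y := by field_simp
      _ ≤ |x - y| / y := by gcongr; exact le_abs_self _
      _ ≤ |x - y| / d := by gcongr
  rw [abs_le]
  constructor
  · have := key y x hy hx
    rw [abs_sub_comm] at this
    linarith
  · exact key x y hx hy

theorem IFSHyp.differentiable_Sword {f : ι → ℝ → ℝ} {g : ι → ℝ × ℝ → ℝ} {α d : ℝ}
    (h : IFSHyp f g α d) (l : List ι) : Differentiable ℝ (Sword f g l) := by
  induction l with
  | nil => exact differentiable_id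
  | cons i l ih =>
    have hS : Differentiable ℝ (Smap f g i) :=
      ((h.diff_f i).comp differentiable_fst).prodMk (h.diff_g i)
    exact hS.comp ih

theorem Sword_fst_eq {ι : Type*} (f : ι → ℝ → ℝ) (g : ι → ℝ × ℝ → ℝ) (l : List ι) (x y z : ℝ) :
    (Sword f g l (x, y)).1 = (Sword f g l (x, z)).1 := by
  induction l with
  | nil => rfl
  | cons i l ih => simp [Sword, Smap, ih]

theorem fxw_singleton {ι : Type*} (f : ι → ℝ → ℝ) (g : ι → ℝ × ℝ → ℝ) (i : ι) (a : ℝ × ℝ) :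
    fxw f g [i] a = deriv (f i) a.1 := rfl

theorem IFSHyp.gxw_singleton {f : ι → ℝ → ℝ} {g : ι → ℝ × ℝ → ℝ} {α d : ℝ}
    (h : IFSHyp f g α d) (i : ι) (a : ℝ × ℝ) :
    gxw f g [i] a = fderiv ℝ (g i) a (1, 0) := by
  have hc : HasDerivAt (fun x : ℝ => (x, a.2)) ((1 : ℝ), (0 : ℝ)) a.1 :=
    (hasDerivAt_id a.1).prodMk (hasDerivAt_const a.1 a.2)
  exact ((h.diff_g i a).hasFDerivAt.comp_hasDerivAt a.1 hc).deriv

theorem IFSHyp.gyw_singleton {f : ι → ℝ → ℝ} {g : ι → ℝ × ℝ → ℝ} {α d : ℝ}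
    (h : IFSHyp f g α d) (i : ι) (a : ℝ × ℝ) :
    gyw f g [i] a = fderiv ℝ (g i) a (0, 1) := by
  have hc : HasDerivAt (fun y : ℝ => (a.1, y)) ((0 : ℝ), (1 : ℝ)) a.2 :=
    (hasDerivAt_const a.2 a.1).prodMk (hasDerivAt_id a.2)
  exact ((h.diff_g i a).hasFDerivAt.comp_hasDerivAt a.2 hc).deriv

theorem IFSHyp.hasDerivAt_Sword_fst {f : ι → ℝ → ℝ} {g : ι → ℝ × ℝ → ℝ} {α d : ℝ}
    (h : IFSHyp f g α d) (l : List ι) (a : ℝ × ℝ) :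
    HasDerivAt (fun x => Sword f g l (x, a.2)) (fxw f g l a, gxw f g l a) a.1 := by
  have hd : DifferentiableAt ℝ (fun x => Sword f g l (x, a.2)) a.1 :=
    (h.differentiable_Sword l _).comp a.1 (by fun_prop)
  exact hd.fst.hasDerivAt.prodMk hd.snd.hasDerivAt

theorem IFSHyp.hasDerivAt_Sword_snd {f : ι → ℝ → ℝ} {g : ι → ℝ × ℝ → ℝ} {α d : ℝ}
    (h : IFSHyp f g α d) (l : List ι) (a : ℝ × ℝ) :
    HasDerivAt (fun y => Sword f g l (a.1, y)) (0, gyw f g l a) a.2 := by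
  have hd : DifferentiableAt ℝ (fun y => Sword f g l (a.1, y)) a.2 :=
    (h.differentiable_Sword l _).comp a.2 (by fun_prop)
  have h1 : HasDerivAt (fun y => (Sword f g l (a.1, y)).1) 0 a.2 := by
    have : (fun y => (Sword f g l (a.1, y)).1) = fun _ => (Sword f g l a).1 :=
      funext fun y => Sword_fst_eq f g l a.1 y a.2
    rw [this]
    exact hasDerivAt_const _ _
  exact h1.prodMk hd.snd.hasDerivAt

theorem IFSHyp.fxw_cons {f : ι → ℝ → ℝ} {g : ι → ℝ × ℝ → ℝ} {α d : ℝ}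
    (h : IFSHyp f g α d) (i : ι) (l : List ι) (a : ℝ × ℝ) :
    fxw f g (i :: l) a = fxw f g [i] (Sword f g l a) * fxw f g l a := by
  have h1 : HasDerivAt (fun x => (Sword f g l (x, a.2)).1) (fxw f g l a) a.1 :=
    (h.hasDerivAt_Sword_fst l a).fst
  exact (HasDerivAt.comp a.1 (h.diff_f i (Sword f g l a).1).hasDerivAt h1).deriv

theorem continuousLinearMap_prod_apply {G : ℝ × ℝ →L[ℝ] ℝ} (u v : ℝ) :
    G (u, v) = G (1, 0) * u + G (0, 1) * v := by
  have : ((u, v) : ℝ × ℝ) = u • ((1, 0) : ℝ × ℝ) + v • ((0, 1) : ℝ × ℝ) := by simp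
  rw [this, map_add, map_smul, map_smul, smul_eq_mul, smul_eq_mul]
  ring

theorem IFSHyp.gxw_cons {f : ι → ℝ → ℝ} {g : ι → ℝ × ℝ → ℝ} {α d : ℝ}
    (h : IFSHyp f g α d) (i : ι) (l : List ι) (a : ℝ × ℝ) :
    gxw f g (i :: l) a = gxw f g [i] (Sword f g l a) * fxw f g l a +
      gyw f g [i] (Sword f g l a) * gxw f g l a := by
  rw [h.gxw_singleton, h.gyw_singleton, ← continuousLinearMap_prod_apply]
  exact ((h.diff_g i (Sword f g l a)).hasFDerivAt.comp_hasDerivAt a.1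
    (h.hasDerivAt_Sword_fst l a)).deriv

theorem IFSHyp.gyw_cons {f : ι → ℝ → ℝ} {g : ι → ℝ × ℝ → ℝ} {α d : ℝ}
    (h : IFSHyp f g α d) (i : ι) (l : List ι) (a : ℝ × ℝ) :
    gyw f g (i :: l) a = gyw f g [i] (Sword f g l a) * gyw f g l a := by
  rw [h.gyw_singleton]
  have := ((h.diff_g i (Sword f g l a)).hasFDerivAt.comp_hasDerivAt a.2
    (h.hasDerivAt_Sword_snd l a)).deriv
  rw [continuousLinearMap_prod_apply, mul_zero, zero_add] at this
  exact this

theorem gyw_nil {ι : Type*} (f : ι → ℝ → ℝ) (g : ι → ℝ × ℝ → ℝ) (a : ℝ × ℝ) : gyw f g [] a = 1 := by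
  simp [gyw, Sword]

theorem fxw_nil {ι : Type*} (f : ι → ℝ → ℝ) (g : ι → ℝ × ℝ → ℝ) (a : ℝ × ℝ) : fxw f g [] a = 1 := by
  simp [fxw, Sword]

theorem gxw_nil {ι : Type*} (f : ι → ℝ → ℝ) (g : ι → ℝ × ℝ → ℝ) (a : ℝ × ℝ) : gxw f g [] a = 0 := by
  simp [gxw, Sword]

/-- Uniform Hölder constant for the derivatives on the unit square. -/
theorem IFSHyp.exists_holder {f : ι → ℝ → ℝ} {g : ι → ℝ × ℝ → ℝ} {α d : ℝ}
    (h : IFSHyp f g α d) : ∃ H, 0 ≤ H ∧ ∀ i, ∀ a ∈ unitSq, ∀ b ∈ unitSq,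
      |fxw f g [i] a - fxw f g [i] b| ≤ H * ‖a - b‖ ^ α ∧
      |gxw f g [i] a - gxw f g [i] b| ≤ H * ‖a - b‖ ^ α ∧
      |gyw f g [i] a - gyw f g [i] b| ≤ H * ‖a - b‖ ^ α := by
  choose H₁ h₁ using h.holder_f
  choose H₂ h₂ using h.holder_g
  obtain ⟨M₁, hM₁⟩ := (Set.finite_range H₁).bddAbove
  obtain ⟨M₂, hM₂⟩ := (Set.finite_range H₂).bddAbove
  refine ⟨max 0 (max M₁ M₂), le_max_left _ _, fun i a ha b hb => ?_⟩
  have e1 : H₁ i ≤ max 0 (max M₁ M₂) :=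
    (hM₁ ⟨i, rfl⟩).trans ((le_max_left _ _).trans (le_max_right _ _))
  have e2 : H₂ i ≤ max 0 (max M₁ M₂) :=
    (hM₂ ⟨i, rfl⟩).trans ((le_max_right _ _).trans (le_max_right _ _))
  have e0 : 0 ≤ max 0 (max M₁ M₂) := le_max_left _ _
  generalize max 0 (max M₁ M₂) = H at *
  have hn : 0 ≤ ‖a - b‖ ^ α := Real.rpow_nonneg (norm_nonneg _) _
  have hg : ∀ v : ℝ × ℝ, ‖v‖ = 1 →
      |fderiv ℝ (g i) a v - fderiv ℝ (g i) b v| ≤ H * ‖a - b‖ ^ α := by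
    intro v hv
    have := (fderiv ℝ (g i) a - fderiv ℝ (g i) b).le_opNorm v
    rw [hv, mul_one] at this
    exact this.trans ((h₂ i a ha b hb).trans (mul_le_mul_of_nonneg_right e2 hn))
  refine ⟨?_, ?_, ?_⟩
  · rw [fxw_singleton, fxw_singleton]
    refine (h₁ i _ ha.1 _ hb.1).trans ((mul_le_mul_of_nonneg_right e1 ?_).trans
      (mul_le_mul_of_nonneg_left ?_ e0))
    · exact Real.rpow_nonneg (abs_nonneg _) _
    · exact Real.rpow_le_rpow (abs_nonneg _) (norm_fst_le (a - b)) h.alpha_pos.le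
  · rw [h.gxw_singleton, h.gxw_singleton]
    exact hg _ (by simp [Prod.norm_def])
  · rw [h.gyw_singleton, h.gyw_singleton]
    exact hg _ (by simp [Prod.norm_def])

theorem IFSHyp.exists_abs_le {f : ι → ℝ → ℝ} {g : ι → ℝ × ℝ → ℝ} {α d : ℝ}
    (h : IFSHyp f g α d) : ∃ K, 0 ≤ K ∧ ∀ i, ∀ a ∈ unitSq,
      |fxw f g [i] a| ≤ K ∧ |gxw f g [i] a| ≤ K ∧ |gyw f g [i] a| ≤ K := by
  obtain ⟨H, hH0, hH⟩ := h.exists_holder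
  obtain ⟨M, hM⟩ := (Set.finite_range
    fun i => |fxw f g [i] 0| + |gxw f g [i] 0| + |gyw f g [i] 0|).bddAbove
  refine ⟨max 0 (M + H), le_max_left _ _, fun i a ha => ?_⟩
  have hMi : |fxw f g [i] 0| + |gxw f g [i] 0| + |gyw f g [i] 0| ≤ M := hM ⟨i, rfl⟩
  have hle : H * ‖a - 0‖ ^ α ≤ H := mul_le_of_le_one_right hH0
    (Real.rpow_le_one (norm_nonneg _) (norm_sub_le_one_of_mem_unitSq ha zero_mem_unitSq)
      h.alpha_pos.le)
  obtain ⟨h1, h2, h3⟩ := hH i a ha 0 zero_mem_unitSq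
  have hmax := le_max_right 0 (M + H)
  have t1 := abs_sub_abs_le_abs_sub (fxw f g [i] a) (fxw f g [i] 0)
  have t2 := abs_sub_abs_le_abs_sub (gxw f g [i] a) (gxw f g [i] 0)
  have t3 := abs_sub_abs_le_abs_sub (gyw f g [i] a) (gyw f g [i] 0)
  have n1 := abs_nonneg (fxw f g [i] 0)
  have n2 := abs_nonneg (gxw f g [i] 0)
  have n3 := abs_nonneg (gyw f g [i] 0)
  refine ⟨?_, ?_, ?_⟩ <;> linarith

/-- Uniform form of the domination condition. -/
theorem IFSHyp.exists_domination {f : ι → ℝ → ℝ} {g : ι → ℝ × ℝ → ℝ} {α d : ℝ}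
    (h : IFSHyp f g α d) : ∃ η, 0 ≤ η ∧ η < 1 ∧ ∀ i, ∀ a ∈ unitSq,
      d ≤ fxw f g [i] a ∧ gyw f g [i] a ≤ η * fxw f g [i] a := by
  have := h.nonempty
  obtain ⟨K, -, hK⟩ := h.exists_abs_le
  have hsup : ∀ i, ∀ a ∈ unitSq, gyw f g [i] a ≤ sSup (gyw f g [i] '' unitSq) := by
    intro i a ha
    refine le_csSup ⟨K, ?_⟩ ⟨a, ha, rfl⟩
    rintro _ ⟨b, hb, rfl⟩
    exact (le_abs_self _).trans (hK i b hb).2.2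
  have hinf : ∀ i, ∀ a ∈ unitSq, sInf (fxw f g [i] '' unitSq) ≤ fxw f g [i] a := by
    intro i a ha
    refine csInf_le ⟨-K, ?_⟩ ⟨a, ha, rfl⟩
    rintro _ ⟨b, hb, rfl⟩
    exact (abs_le.mp (hK i b hb).1).1
  have hdom := h.dom
  have hds : ∀ i, d ≤ sSup (gyw f g [i] '' unitSq) := fun i =>
    (h.dom_d i 0 zero_mem_unitSq).trans (hsup i 0 zero_mem_unitSq)
  have hd := h.d_pos
  obtain ⟨i₀, hi₀⟩ := Finite.exists_max
    (fun i => sSup (gyw f g [i] '' unitSq) / sInf (fxw f g [i] '' unitSq))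
  have hpos : ∀ i, 0 < sInf (fxw f g [i] '' unitSq) := fun i => by
    linarith [hdom i, hds i]
  have hη0 : 0 ≤ sSup (gyw f g [i₀] '' unitSq) / sInf (fxw f g [i₀] '' unitSq) :=
    div_nonneg (hd.le.trans (hds i₀)) (hpos i₀).le
  refine ⟨_, hη0, (div_lt_one (hpos i₀)).mpr (hdom i₀), fun i a ha => ⟨?_, ?_⟩⟩
  · linarith [hdom i, hds i, hinf i a ha]
  · calc gyw f g [i] a ≤ sSup (gyw f g [i] '' unitSq) := hsup i a ha
      _ = sSup (gyw f g [i] '' unitSq) / sInf (fxw f g [i] '' unitSq) *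
          sInf (fxw f g [i] '' unitSq) := (div_mul_cancel₀ _ (hpos i).ne').symm
      _ ≤ _ := mul_le_mul (hi₀ i) (hinf i a ha) (hpos i).le hη0

/-- The Jacobian entries along words: positivity of the diagonal, and domination of the other
entries by the top-left one. -/
theorem IFSHyp.exists_jacobian_bounds {f : ι → ℝ → ℝ} {g : ι → ℝ × ℝ → ℝ} {α d : ℝ}
    (h : IFSHyp f g α d) : ∃ C, ∀ (l : List ι), ∀ a ∈ unitSq,
      0 < fxw f g l a ∧ 0 < gyw f g l a ∧ gyw f g l a ≤ fxw f g l a ∧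
        |gxw f g l a| ≤ C * fxw f g l a := by
  obtain ⟨η, hη0, hη1, hη⟩ := h.exists_domination
  obtain ⟨K, hK0, hK⟩ := h.exists_abs_le
  have hd := h.d_pos
  have h1η : 0 < 1 - η := by linarith
  have hC : K = (1 - η) * d * (K / (d * (1 - η))) := by field_simp
  have hC0 : 0 ≤ K / (d * (1 - η)) := by positivity
  refine ⟨K / (d * (1 - η)), fun l a ha => ?_⟩
  generalize K / (d * (1 - η)) = C at *
  induction l with
  | nil => simp [fxw_nil, gyw_nil, gxw_nil, hC0]
  | cons i l ih =>
    obtain ⟨hF, hY, hYF, hX⟩ := ih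
    have hS := h.Sword_mem l ha
    obtain ⟨hfd, hgη⟩ := hη i _ hS
    have hgd := h.dom_d i _ hS
    have hgx := (hK i _ hS).2.1
    rw [h.fxw_cons, h.gyw_cons, h.gxw_cons]
    set fi := fxw f g [i] (Sword f g l a)
    set xi := gxw f g [i] (Sword f g l a)
    set yi := gyw f g [i] (Sword f g l a)
    have hfi : 0 < fi := hd.trans_le hfd
    have hyi : 0 < yi := hd.trans_le hgd
    have hyf : yi ≤ fi := hgη.trans (mul_le_of_le_one_left hfi.le hη1.le)
    refine ⟨mul_pos hfi hF, mul_pos hyi hY, mul_le_mul hyf hYF hY.le hfi.le, ?_⟩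
    calc |xi * fxw f g l a + yi * gxw f g l a|
        ≤ |xi| * fxw f g l a + yi * |gxw f g l a| := by
          refine (abs_add_le _ _).trans_eq ?_
          rw [abs_mul, abs_mul, abs_of_pos hF, abs_of_pos hyi]
      _ ≤ K * fxw f g l a + η * fi * (C * fxw f g l a) := by gcongr
      _ ≤ (1 - η) * fi * C * fxw f g l a + η * fi * (C * fxw f g l a) := by
          gcongr
          rw [hC]
          gcongr
      _ = C * (fi * fxw f g l a) := by ring

theorem sv_discrim_nonneg (a b c : ℝ) :
    (a ^ 2 - c ^ 2) ^ 2 ≤ (a ^ 2 + b ^ 2 + c ^ 2) ^ 2 - 4 * (a * c) ^ 2 := by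
  nlinarith [mul_nonneg (sq_nonneg a) (sq_nonneg b), mul_nonneg (sq_nonneg b) (sq_nonneg c),
    mul_nonneg (sq_nonneg b) (sq_nonneg b)]

theorem le_sv1 {a c : ℝ} (b : ℝ) : a ≤ sv1 a b c := by
  refine Real.le_sqrt_of_sq_le ?_
  have h1 : a ^ 2 - c ^ 2 ≤ Real.sqrt ((a ^ 2 + b ^ 2 + c ^ 2) ^ 2 - 4 * (a * c) ^ 2) :=
    Real.le_sqrt_of_sq_le (sv_discrim_nonneg a b c)
  nlinarith [sq_nonneg b]

theorem sv1_le {a b c C : ℝ} (hc : 0 ≤ c) (hca : c ≤ a) (hb : |b| ≤ C * a) :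
    sv1 a b c ≤ Real.sqrt (2 + C ^ 2) * a := by
  have ha : 0 ≤ a := hc.trans hca
  have hN : 0 ≤ a ^ 2 + b ^ 2 + c ^ 2 := by positivity
  have h1 : Real.sqrt ((a ^ 2 + b ^ 2 + c ^ 2) ^ 2 - 4 * (a * c) ^ 2) ≤
      a ^ 2 + b ^ 2 + c ^ 2 :=
    (Real.sqrt_le_left hN).mpr (by nlinarith [sq_nonneg (a * c)])
  have hb2 : b ^ 2 ≤ (C * a) ^ 2 := sq_le_sq' (by linarith [neg_abs_le b])
    ((le_abs_self b).trans hb)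
  have hc2 : c ^ 2 ≤ a ^ 2 := by gcongr
  rw [← Real.sqrt_sq ha, ← Real.sqrt_mul (by positivity), Real.sqrt_sq ha]
  refine Real.sqrt_le_sqrt ?_
  nlinarith

theorem sv1_mul_sv2 {a c : ℝ} (b : ℝ) (ha : 0 ≤ a) (hc : 0 ≤ c) :
    sv1 a b c * sv2 a b c = a * c := by
  have h0 := (sq_nonneg _).trans (sv_discrim_nonneg a b c)
  have hsq := Real.sq_sqrt h0
  unfold sv1 sv2
  rw [← Real.sqrt_mul (by positivity)]
  refine (congrArg Real.sqrt ?_).trans (Real.sqrt_sq (mul_nonneg ha hc))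
  linear_combination (-1 / 4) * hsq

theorem pword_pos {ι : Type*} {p : ι → ℝ} (hp : ∀ i, 0 < p i) (l : List ι) : 0 < pword p l := by
  induction l with
  | nil => simp [pword]
  | cons i l ih => simpa [pword] using mul_pos (hp i) ih

theorem IFSHyp.wordSum_logPotential {f : ι → ℝ → ℝ} {g : ι → ℝ × ℝ → ℝ} {α d : ℝ}
    (h : IFSHyp f g α d) {p : ι → ℝ} (hp : ∀ i, 0 < p i) (s q βq : ℝ) (l : List ι)
    {a : ℝ × ℝ} (ha : a ∈ unitSq) :
    wordSum f g (logPotential f g p s q βq) l a =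
      q * Real.log (pword p l) + βq * Real.log (fxw f g l a) +
        (s - βq) * Real.log (gyw f g l a) := by
  obtain ⟨C, hC⟩ := h.exists_jacobian_bounds
  induction l with
  | nil => simp [wordSum, pword, fxw_nil, gyw_nil]
  | cons i l ih =>
    have hS := h.Sword_mem l ha
    have e : pword p (i :: l) = p i * pword p l := by simp [pword]
    rw [wordSum, ih, h.fxw_cons, h.gyw_cons, e,
      Real.log_mul (hp i).ne' (pword_pos hp l).ne',
      Real.log_mul (hC [i] _ hS).1.ne' (hC l a ha).1.ne',
      Real.log_mul (hC [i] _ hS).2.1.ne' (hC l a ha).2.1.ne', logPotential]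
    ring

/-- The modified singular value function is uniformly comparable to the exponential of the
Birkhoff sum of `logPotential`. -/
theorem IFSHyp.exists_psiSV_eq {f : ι → ℝ → ℝ} {g : ι → ℝ × ℝ → ℝ} {α d : ℝ}
    (h : IFSHyp f g α d) {p : ι → ℝ} (hp : ∀ i, 0 < p i) (s q βq : ℝ) :
    ∃ E, ∀ (l : List ι), ∀ a ∈ unitSq, ∃ t, |t| ≤ E ∧ psiSV f g p s q βq a l =
      Real.exp (wordSum f g (logPotential f g p s q βq) l a + t) := by
  obtain ⟨C, hC⟩ := h.exists_jacobian_bounds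
  refine ⟨|2 * βq - s| * Real.log (Real.sqrt (2 + C ^ 2)), fun l a ha => ?_⟩
  obtain ⟨hF, hY, hYF, hX⟩ := hC l a ha
  have hlow : fxw f g l a ≤ alphaOne f g l a := le_sv1 _
  have hupp : alphaOne f g l a ≤ Real.sqrt (2 + C ^ 2) * fxw f g l a := sv1_le hY.le hYF hX
  have hprod : alphaOne f g l a * alphaTwo f g l a = fxw f g l a * gyw f g l a :=
    sv1_mul_sv2 _ hF.le hY.le
  have h1 : 0 < alphaOne f g l a := hF.trans_le hlow
  have h2 : 0 < alphaTwo f g l a := by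
    have := mul_pos hF hY
    rw [← hprod] at this
    exact (pos_iff_pos_of_mul_pos this).mp h1
  have hp0 := pword_pos hp l
  have hL : Real.log (alphaOne f g l a) + Real.log (alphaTwo f g l a) =
      Real.log (fxw f g l a) + Real.log (gyw f g l a) := by
    rw [← Real.log_mul h1.ne' h2.ne', hprod, Real.log_mul hF.ne' hY.ne']
  have hl1 := Real.log_le_log hF hlow
  have hl2 := Real.log_le_log h1 hupp
  rw [Real.log_mul (by positivity) hF.ne'] at hl2
  refine ⟨(2 * βq - s) * (Real.log (alphaOne f g l a) - Real.log (fxw f g l a)), ?_, ?_⟩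
  · rw [abs_mul]
    gcongr
    rw [abs_of_nonneg (by linarith)]
    linarith
  · rw [h.wordSum_logPotential hp s q βq l ha, psiSV, Real.rpow_def_of_pos hp0,
      Real.rpow_def_of_pos h1, Real.rpow_def_of_pos h2, ← Real.exp_add, ← Real.exp_add]
    congr 1
    linear_combination (s - βq) * hL

theorem IFSHyp.exists_holder_logPotential {f : ι → ℝ → ℝ} {g : ι → ℝ × ℝ → ℝ} {α d : ℝ}
    (h : IFSHyp f g α d) (p : ι → ℝ) (s q βq : ℝ) :
    ∃ H, 0 ≤ H ∧ ∀ i, ∀ a ∈ unitSq, ∀ b ∈ unitSq,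
      |logPotential f g p s q βq i a - logPotential f g p s q βq i b| ≤ H * ‖a - b‖ ^ α := by
  obtain ⟨H, hH0, hH⟩ := h.exists_holder
  obtain ⟨η, -, -, hη⟩ := h.exists_domination
  have hd := h.d_pos
  refine ⟨(|βq| + |s - βq|) * (H / d), by positivity, fun i a ha b hb => ?_⟩
  obtain ⟨h1, -, h3⟩ := hH i a ha b hb
  have l1 := abs_log_sub_log_le hd (hη i a ha).1 (hη i b hb).1
  have l2 := abs_log_sub_log_le hd (h.dom_d i a ha) (h.dom_d i b hb)
  calc |logPotential f g p s q βq i a - logPotential f g p s q βq i b|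
      = |βq * (Real.log (fxw f g [i] a) - Real.log (fxw f g [i] b)) +
          (s - βq) * (Real.log (gyw f g [i] a) - Real.log (gyw f g [i] b))| := by
        unfold logPotential
        congr 1
        ring
    _ ≤ |βq| * |Real.log (fxw f g [i] a) - Real.log (fxw f g [i] b)| +
          |s - βq| * |Real.log (gyw f g [i] a) - Real.log (gyw f g [i] b)| := by
        rw [← abs_mul, ← abs_mul]
        exact abs_add_le _ _
    _ ≤ |βq| * (H * ‖a - b‖ ^ α / d) + |s - βq| * (H * ‖a - b‖ ^ α / d) := by
        gcongr
        · exact l1.trans (by gcongr)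
        · exact l2.trans (by gcongr)
    _ = (|βq| + |s - βq|) * (H / d) * ‖a - b‖ ^ α := by ring

/-- Sequences within bounded multiplicative distance of each other have the same exponential
growth rate. -/
theorem tendsto_rpow_inv_of_comparable {x y : ℕ → ℝ} {K P : ℝ} (hx : ∀ k, 0 < x k)
    (hle : ∀ k, y k ≤ Real.exp K * x k) (hge : ∀ k, x k ≤ Real.exp K * y k)
    (hlim : Tendsto (fun k : ℕ => Real.log (x k) / k) atTop (𝓝 P)) :
    Tendsto (fun k : ℕ => y k ^ ((k : ℝ)⁻¹)) atTop (𝓝 (Real.exp P)) := by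
  have hy : ∀ k, 0 < y k := fun k =>
    pos_of_mul_pos_right ((hx k).trans_le (hge k)) (Real.exp_pos K).le
  have hlog : Tendsto (fun k : ℕ => Real.log (y k) / k) atTop (𝓝 P) := by
    have hK := tendsto_const_div_atTop_nhds_zero_nat K
    have hlo := hlim.sub hK
    have hhi := hlim.add hK
    rw [sub_zero] at hlo
    rw [add_zero] at hhi
    refine tendsto_of_tendsto_of_tendsto_of_le_of_le hlo hhi (fun k => ?_) (fun k => ?_)
    · have := Real.log_le_log (hx k) (hge k)
      rw [Real.log_mul (Real.exp_pos _).ne' (hy k).ne', Real.log_exp] at this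
      simp only [← sub_div]
      gcongr
      linarith
    · have := Real.log_le_log (hy k) (hle k)
      rw [Real.log_mul (Real.exp_pos _).ne' (hx k).ne', Real.log_exp] at this
      simp only [← add_div]
      gcongr
      linarith
  refine ((Real.continuous_exp.tendsto P).comp hlog).congr fun k => ?_
  rw [Function.comp_apply, Real.rpow_def_of_pos (hy k), div_eq_mul_inv]

theorem pressure_exists {ι : Type*} [Fintype ι]
    (f : ι → ℝ → ℝ) (g : ι → ℝ × ℝ → ℝ) (α d : ℝ) (h : IFSHyp f g α d)
    (p : ι → ℝ) (hp : ProbVec p) (s q βq : ℝ) (hq : 0 ≤ q) :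
    ∃ Pv : ℝ, ∀ a ∈ unitSq,
      Tendsto (fun k : ℕ => PsiSum f g p s q βq a k ^ ((k : ℝ)⁻¹)) atTop (𝓝 Pv) := by
  have := h.nonempty
  have hp0 : ∀ i, 0 < p i := fun i => (hp.1 i).1
  obtain ⟨H, hH0, hH⟩ := h.exists_holder_logPotential p s q βq
  obtain ⟨D, hD⟩ := h.exists_distortion hH0 hH
  obtain ⟨E, hE⟩ := h.exists_psiSV_eq hp0 s q βq
  obtain ⟨P, hP⟩ := h.exists_tendsto_log_partitionSum hH0 hH
  refine ⟨Real.exp P, fun a ha => tendsto_rpow_inv_of_comparable (K := D + E)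
    (fun k => partitionSum_pos f g (logPotential f g p s q βq) k 0)
    (fun k => ?_) (fun k => ?_) hP⟩
  · unfold PsiSum partitionSum
    rw [Finset.mul_sum]
    refine Finset.sum_le_sum fun w _ => ?_
    obtain ⟨t, ht, heq⟩ := hE (List.ofFn w) a ha
    rw [heq, ← Real.exp_add]
    refine Real.exp_le_exp.mpr ?_
    linarith [hD (List.ofFn w) a ha 0 zero_mem_unitSq, le_abs_self t]
  · unfold PsiSum partitionSum
    rw [Finset.mul_sum]
    refine Finset.sum_le_sum fun w _ => ?_
    obtain ⟨t, ht, heq⟩ := hE (List.ofFn w) a ha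
    rw [heq, ← Real.exp_add]
    refine Real.exp_le_exp.mpr ?_
    linarith [hD (List.ofFn w) 0 zero_mem_unitSq a ha, neg_abs_le t]

end
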